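/- arXiv:0809.0724 — 2 statements merged into one kernel-verified Lean document; each statement's English description precedes it below -/
import Mathlib

section
/- Let k, ℓ ≥ 1 be integers and let G be a finite simple graph containing a bramble of order at least k·ℓ. Then G contains ℓ pairwise vertex-disjoint paths P₁, …, P_ℓ such that for every pair of distinct indices i, j ∈ {1, …, ℓ}, G contains k pairwise vertex-disjoint paths each having one endpoint in P_i, the other endpoint in P_j. -/
open SimpleGraph

/-- `H` is a minor of `G`: there are nonempty, pairwise disjoint, connected
branch sets in `G`, one for each vertex of `H`, such that adjacent vertices
of `H` have an edge of `G` between their branch sets. -/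
def MinorOf {α β : Type*} (H : SimpleGraph α) (G : SimpleGraph β) : Prop :=
  ∃ B : α → Set β,
    (Pairwise fun a b => Disjoint (B a) (B b)) ∧
    (∀ a, (G.induce (B a)).Connected) ∧
    (∀ a b, H.Adj a b → ∃ u ∈ B a, ∃ v ∈ B b, G.Adj u v)

/-- A tree decomposition of a graph `G`. -/
structure TreeDecomp {V : Type} (G : SimpleGraph V) where
  ι : Type
  tree : SimpleGraph ι
  isTree : tree.IsTree
  bag : ι → Finset V
  mem_bag : ∀ v : V, ∃ i, v ∈ bag i
  adj_bag : ∀ u v : V, G.Adj u v → ∃ i, u ∈ bag i ∧ v ∈ bag i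
  connected_bag : ∀ v : V, (tree.induce {i | v ∈ bag i}).Connected

/-- The width of a tree decomposition: maximum bag size minus one. -/
noncomputable def TreeDecomp.width {V : Type} {G : SimpleGraph V}
    (td : TreeDecomp G) : ℕ :=
  sSup {n | ∃ i, n = (td.bag i).card} - 1

/-- The treewidth of a finite graph. -/
noncomputable def treewidth {V : Type} [Fintype V] (G : SimpleGraph V) : ℕ :=
  sInf {w | ∃ td : TreeDecomp G, td.width = w}

/-- A path in `G`, together with its endpoints. -/
def PathIn {V : Type} (G : SimpleGraph V) : Type := Σ u v : V, G.Path u v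

/-- The set of vertices of a path. -/
def PathIn.verts {V : Type} {G : SimpleGraph V} (P : PathIn G) : Set V :=
  {v | v ∈ (P.2.2 : G.Walk P.1 P.2.1).support}

/-- The intersection graph of a set of paths: two paths are adjacent iff they
are distinct and share a vertex. -/
def pathIntersectionGraph {V : Type} (G : SimpleGraph V)
    (𝒬 : Set (PathIn G)) : SimpleGraph 𝒬 :=
  SimpleGraph.fromRel fun P Q => ∃ v, v ∈ (P : PathIn G).verts ∧ v ∈ (Q : PathIn G).verts

/-- A grid-like-minor of order `ℓ` in `G`: a set of paths whose intersection
graph is bipartite and contains a `K_ℓ`-minor. -/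
def IsGridLikeMinor {V : Type} (G : SimpleGraph V) (ℓ : ℕ)
    (𝒬 : Set (PathIn G)) : Prop :=
  (pathIntersectionGraph G 𝒬).Colorable 2 ∧
    MinorOf (completeGraph (Fin ℓ)) (pathIntersectionGraph G 𝒬)

/-- Two subgraphs touch if they share a vertex or there is an edge of `G`
between them. -/
def Touch {V : Type} {G : SimpleGraph V} (X Y : G.Subgraph) : Prop :=
  (X.verts ∩ Y.verts).Nonempty ∨ ∃ u ∈ X.verts, ∃ v ∈ Y.verts, G.Adj u v

/-- A bramble: a set of pairwise touching connected subgraphs. -/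
def IsBramble {V : Type} {G : SimpleGraph V} (ℬ : Set G.Subgraph) : Prop :=
  (∀ X ∈ ℬ, X.Connected) ∧ ∀ X ∈ ℬ, ∀ Y ∈ ℬ, Touch X Y

/-- The order of a bramble is at least `k`: every hitting set has at least `k`
vertices. -/
def BrambleOrderAtLeast {V : Type} {G : SimpleGraph V} (ℬ : Set G.Subgraph)
    (k : ℕ) : Prop :=
  ∀ S : Finset V, (∀ X ∈ ℬ, ∃ v ∈ S, v ∈ X.verts) → k ≤ S.card

/-- The intersection graph of a set of subgraphs: two subgraphs are adjacent
iff they are distinct and share a vertex. -/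
def subgraphIntersectionGraph {V : Type} (G : SimpleGraph V)
    (𝒳 : Set G.Subgraph) : SimpleGraph 𝒳 :=
  SimpleGraph.fromRel fun X Q => ((X : G.Subgraph).verts ∩ (Q : G.Subgraph).verts).Nonempty

/-- A graph is `d`-degenerate if every nonempty (induced) subgraph has a vertex
of degree at most `d`. -/
def IsDegenerate {W : Type*} (d : ℕ) (G : SimpleGraph W) : Prop :=
  ∀ s : Set W, s.Nonempty → ∃ v ∈ s, {u | u ∈ s ∧ G.Adj v u}.ncard ≤ d

open Classical in
/-- Every walk contains a path with the same endpoints. -/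
lemma PathIn.exists_of_walk {V : Type} {G : SimpleGraph V} {u v : V} (p : G.Walk u v) :
    ∃ P : PathIn G, P.1 = u ∧ P.2.1 = v ∧ ∀ w ∈ P.verts, w ∈ p.support :=
  ⟨⟨u, v, p.toPath⟩, rfl, rfl, fun _ hw => p.support_toPath_subset_support hw⟩

/-- `v` is reachable from `A` by a walk avoiding `S`. -/
def ReachAvoiding {V : Type} (G : SimpleGraph V) (A S : Set V) (v : V) : Prop :=
  ∃ a ∈ A, ∃ p : G.Walk a v, ∀ w ∈ p.support, w ∉ S

/-- `S` meets every walk from `A` to `B`. -/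
def Separates {V : Type} (G : SimpleGraph V) (A B S : Set V) : Prop :=
  ∀ b ∈ B, ¬ ReachAvoiding G A S b

namespace ReachAvoiding

variable {V : Type} {G : SimpleGraph V} {A B S T : Set V} {u v : V}

lemma notMem (h : ReachAvoiding G A S v) : v ∉ S := by
  obtain ⟨a, _, p, hp⟩ := h
  exact hp v p.end_mem_support

lemma of_mem (hv : v ∈ A) (hS : v ∉ S) : ReachAvoiding G A S v :=
  ⟨v, hv, .nil, by simpa⟩

lemma step (h : ReachAvoiding G A S u) (huv : G.Adj u v) (hv : v ∉ S) :
    ReachAvoiding G A S v := by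
  obtain ⟨a, ha, p, hp⟩ := h
  refine ⟨a, ha, p.concat huv, fun w hw => ?_⟩
  simp only [Walk.support_concat, List.mem_append, List.mem_singleton] at hw
  rcases hw with hw | rfl
  exacts [hp w hw, hv]

lemma mono (h : ReachAvoiding G A T v) (hS : ∀ w ∈ S, ¬ ReachAvoiding G A T w) :
    ReachAvoiding G A S v := by
  classical
  obtain ⟨a, ha, p, hp⟩ := h
  exact ⟨a, ha, p, fun w hw hwS => hS w hwS
    ⟨a, ha, p.takeUntil w hw, fun z hz => hp z (p.support_takeUntil_subset_support hw hz)⟩⟩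

lemma separates_trans (hsep : Separates G A B S) (hA : ReachAvoiding G A S v)
    (hB : ReachAvoiding G B S v) : False := by
  obtain ⟨a, ha, p, hp⟩ := hA
  obtain ⟨b, hb, q, hq⟩ := hB
  refine hsep b hb ⟨a, ha, p.append q.reverse, fun w hw => ?_⟩
  rw [Walk.mem_support_append_iff, Walk.support_reverse, List.mem_reverse] at hw
  exact hw.elim (hp w) (hq w)

/-- A walk leaving the set of vertices reachable from `A` in `H` uses an edge outside `H`. -/
lemma exists_boundary {H : SimpleGraph V} (hG : ReachAvoiding G A S v)
    (hH : ¬ ReachAvoiding H A S v) :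
    ∃ x y, G.Adj x y ∧ ¬ H.Adj x y ∧ ReachAvoiding H A S x := by
  obtain ⟨a, ha, p, hp⟩ := hG
  obtain ⟨d, hd, h₁, h₂⟩ := p.exists_boundary_dart {w | ReachAvoiding H A S w}
    (of_mem ha (hp a p.start_mem_support)) hH
  exact ⟨d.fst, d.snd, d.adj,
    fun h => h₂ (ReachAvoiding.step h₁ h (hp _ (p.dart_snd_mem_support_of_mem_darts hd))), h₁⟩

end ReachAvoiding

namespace Separates

variable {V : Type} {G : SimpleGraph V} {A B S : Set V}

lemma symm (h : Separates G A B S) : Separates G B A S := by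
  rintro a ha ⟨b, hb, p, hp⟩
  exact h b hb ⟨a, ha, p.reverse, by simpa using hp⟩

lemma insert_of_deleteEdge {x y : V} {Z : Set V}
    (hS : Separates (G.deleteEdges {s(x, y)}) A B S)
    (hy : ReachAvoiding (G.deleteEdges {s(x, y)}) B S y)
    (hZ : Separates (G.deleteEdges {s(x, y)}) A (insert x S) Z) : Separates G A B Z := by
  intro b hb hG
  have key : ∀ w, ReachAvoiding (G.deleteEdges {s(x, y)}) A Z w →
      ReachAvoiding (G.deleteEdges {s(x, y)}) A S w :=
    fun w hw => hw.mono fun z hz => hZ z (Set.mem_insert_of_mem _ hz)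
  obtain ⟨u, v, huv, hn, hu⟩ := hG.exists_boundary (fun h => hS b hb (key b h))
  have huvxy : s(u, v) = s(x, y) := by
    by_contra hne
    exact hn (by simpa [deleteEdges_adj, huv] using hne)
  rcases Sym2.eq_iff.1 huvxy with ⟨rfl, rfl⟩ | ⟨rfl, rfl⟩
  · exact hZ u (Set.mem_insert _ _) hu
  · exact ReachAvoiding.separates_trans hS (key _ hu) hy

end Separates

/-- Disjoint paths from `A` to a set of as many vertices can be indexed by their last vertices. -/
lemma exists_paths_indexed_by_end {V : Type} {G : SimpleGraph V} {A : Set V} {T : Finset V}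
    {k : ℕ} (hT : T.card = k) (P : Fin k → PathIn G)
    (hdisj : Pairwise fun i j => Disjoint (P i).verts (P j).verts)
    (hP : ∀ i, (P i).1 ∈ A ∧ (P i).2.1 ∈ T) :
    ∃ (a : T → V) (p : ∀ t : T, G.Path (a t) t), (∀ t, a t ∈ A) ∧
      ∀ t t' v, v ∈ (p t : G.Walk (a t) t).support →
        v ∈ (p t' : G.Walk (a t') t').support → t = t' := by
  have hinj : Function.Injective fun i => (⟨(P i).2.1, (hP i).2⟩ : T) := by
    intro i j hij
    by_contra hne
    have h : (P i).2.1 = (P j).2.1 := congrArg Subtype.val hij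
    have hi : (P i).2.1 ∈ (P i).verts := Walk.end_mem_support _
    have hj : (P j).2.1 ∈ (P j).verts := Walk.end_mem_support _
    exact Set.disjoint_left.1 (hdisj hne) hi (h ▸ hj)
  have hsurj := ((Fintype.bijective_iff_injective_and_card _).2
    ⟨hinj, by simp [hT]⟩).surjective
  choose f hf using hsurj
  have hf' : ∀ t, (P (f t)).2.1 = t := fun t => congrArg Subtype.val (hf t)
  refine ⟨fun t => (P (f t)).1, fun t => ⟨((P (f t)).2.2 : G.Walk _ _).copy rfl (hf' t), ?_⟩,
    fun t => (hP _).1, fun t t' v hv hv' => ?_⟩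
  · simp
  · rw [Walk.support_copy] at hv hv'
    by_contra hne
    refine Set.disjoint_left.1 (hdisj (i := f t) (j := f t') fun h => hne ?_) hv hv'
    rw [← hf t, ← hf t', h]

/-- A path ending in `t` that meets `S` at most in `t` reaches all its vertices outside `S`
while avoiding `S`. -/
lemma ReachAvoiding.of_mem_path {V : Type} {G : SimpleGraph V} {A S : Set V} {a t v : V}
    (ha : a ∈ A) (p : G.Path a t) (hp : ∀ w ∈ S, w ∈ (p : G.Walk a t).support → w = t)
    (hv : v ∈ (p : G.Walk a t).support) (hvS : v ∉ S) : ReachAvoiding G A S v := by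
  classical
  refine ⟨a, ha, (p : G.Walk a t).takeUntil v hv, fun w hw hwS => ?_⟩
  obtain rfl := hp w hwS (Walk.support_takeUntil_subset_support _ hv hw)
  exact Walk.endpoint_notMem_support_takeUntil p.2 hv (fun h => hvS (h ▸ hwS)) hw

/-- Gluing paths from `A` and from `B` across a small separator of `G - xy`. -/
lemma exists_disjoint_paths_of_separates_deleteEdge {V : Type} {G : SimpleGraph V} {A B : Set V}
    {k : ℕ} {x y : V} (hxy : G.Adj x y)
    (ih : ∀ A B : Set V,
      (∀ S : Finset V, Separates (G.deleteEdges {s(x, y)}) A B S → k ≤ S.card) →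
      ∃ P : Fin k → PathIn (G.deleteEdges {s(x, y)}),
        (Pairwise fun i j => Disjoint (P i).verts (P j).verts) ∧
        ∀ i, (P i).1 ∈ A ∧ (P i).2.1 ∈ B)
    (hsep : ∀ S : Finset V, Separates G A B S → k ≤ S.card)
    {S : Finset V} (hS : Separates (G.deleteEdges {s(x, y)}) A B S) (hcard : S.card < k)
    (hx : ReachAvoiding (G.deleteEdges {s(x, y)}) A S x)
    (hy : ReachAvoiding (G.deleteEdges {s(x, y)}) B S y) :
    ∃ P : Fin k → PathIn G, (Pairwise fun i j => Disjoint (P i).verts (P j).verts) ∧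
      ∀ i, (P i).1 ∈ A ∧ (P i).2.1 ∈ B := by
  classical
  set H := G.deleteEdges {s(x, y)} with hH
  have hswap : G.deleteEdges {s(y, x)} = H := by rw [hH, Sym2.eq_swap]
  have hle : H ≤ G := G.deleteEdges_le _
  have hxS : x ∉ S := fun h => hx.notMem h
  have hyS : y ∉ S := fun h => hy.notMem h
  have hsA : ∀ Z : Finset V, Separates H A (insert x S : Finset V) Z → k ≤ Z.card :=
    fun Z hZ => hsep Z (hS.insert_of_deleteEdge hy (by simpa using hZ))
  have hsB : ∀ Z : Finset V, Separates H B (insert y S : Finset V) Z → k ≤ Z.card := by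
    intro Z hZ
    refine hsep Z (Separates.symm (Separates.insert_of_deleteEdge (x := y) (y := x) (S := S)
      ?_ ?_ ?_))
    · rw [hswap]; exact hS.symm
    · rw [hswap]; exact hx
    · rw [hswap]; simpa using hZ
  have hcx : (insert x S).card = k := by
    refine le_antisymm (by rw [Finset.card_insert_of_notMem hxS]; omega) (hsA _ ?_)
    exact fun b hb h => h.notMem hb
  have hcy : (insert y S).card = k := by
    rw [← hcx, Finset.card_insert_of_notMem hxS, Finset.card_insert_of_notMem hyS]
  obtain ⟨P, hPd, hP⟩ := ih A _ hsA
  obtain ⟨Q, hQd, hQ⟩ := ih B _ hsB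
  obtain ⟨a, p, haA, hp⟩ := exists_paths_indexed_by_end hcx P hPd (fun i => by simpa using hP i)
  obtain ⟨b, q, hbB, hq⟩ := exists_paths_indexed_by_end hcy Q hQd (fun i => by simpa using hQ i)
  have hpS : ∀ t, ∀ w ∈ (S : Set V), w ∈ (p t).1.support → w = t := by
    intro t w hw hwt
    have h := hp ⟨w, Finset.mem_insert_of_mem hw⟩ t w (Walk.end_mem_support _) hwt
    exact congrArg Subtype.val h
  have hqS : ∀ t, ∀ w ∈ (S : Set V), w ∈ (q t).1.support → w = t := by
    intro t w hw hwt
    have h := hq ⟨w, Finset.mem_insert_of_mem hw⟩ t w (Walk.end_mem_support _) hwt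
    exact congrArg Subtype.val h
  have hpq : ∀ t t' v, v ∈ (p t).1.support → v ∈ (q t').1.support →
      v ∈ S ∧ v = t ∧ v = t' := by
    intro t t' v hv hv'
    by_cases hvS : v ∈ S
    · exact ⟨hvS, hpS t v hvS hv, hqS t' v hvS hv'⟩
    · exact (ReachAvoiding.separates_trans hS
        (ReachAvoiding.of_mem_path (haA t) (p t) (hpS t) hv hvS)
        (ReachAvoiding.of_mem_path (hbB t') (q t') (hqS t') hv' hvS)).elim
  have hσ : ∀ t : (insert x S : Finset V), ∃ s : (insert y S : Finset V),
      (t : V) = x ∧ (s : V) = y ∨ (t : V) ∈ S ∧ (s : V) = t := by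
    rintro ⟨t, ht⟩
    rcases Finset.mem_insert.1 ht with rfl | h
    · exact ⟨⟨y, Finset.mem_insert_self _ _⟩, .inl ⟨rfl, rfl⟩⟩
    · exact ⟨⟨t, Finset.mem_insert_of_mem h⟩, .inr ⟨h, rfl⟩⟩
  choose σ hσ using hσ
  have hσinj : ∀ t t', σ t = σ t' → t = t' := by
    intro t t' h
    have h' : (σ t : V) = σ t' := congrArg Subtype.val h
    apply Subtype.ext
    grind
  have hglue : ∀ t, ∃ R : PathIn G, R.1 = a t ∧ R.2.1 = b (σ t) ∧
      ∀ w ∈ R.verts, w ∈ (p t).1.support ∨ w ∈ (q (σ t)).1.support := by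
    intro t
    have hm : ∃ m : G.Walk t (σ t), ∀ w ∈ m.support, w = t ∨ w = σ t := by
      rcases hσ t with ⟨h₁, h₂⟩ | ⟨_, h₂⟩
      · exact ⟨Walk.cons (by rwa [h₁, h₂]) .nil, by simp⟩
      · exact ⟨Walk.nil.copy rfl h₂.symm, by simp⟩
    obtain ⟨m, hm⟩ := hm
    obtain ⟨R, h₁, h₂, hR⟩ := PathIn.exists_of_walk
      ((((p t).1.mapLe hle).append m).append ((q (σ t)).1.mapLe hle).reverse)
    refine ⟨R, h₁, h₂, fun w hw => ?_⟩
    have := hR w hw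
    simp only [Walk.mem_support_append_iff, Walk.support_reverse, List.mem_reverse,
      Walk.support_mapLe_eq_support] at this
    rcases this with (h | h) | h
    · exact .inl h
    · rcases hm w h with rfl | rfl
      · exact .inl (Walk.end_mem_support _)
      · exact .inr (Walk.end_mem_support _)
    · exact .inr h
  choose R hR₁ hR₂ hR using hglue
  have hRd : ∀ t t', t ≠ t' → Disjoint (R t).verts (R t').verts := by
    have hcross : ∀ t t' v, v ∈ (p t).1.support →
        v ∈ (q (σ t')).1.support → t = t' := by
      intro t t' v hv hv'
      obtain ⟨hvS, h₁, h₂⟩ := hpq _ _ _ hv hv'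
      apply Subtype.ext
      rcases hσ t' with ⟨_, h⟩ | ⟨_, h⟩
      · exact (hyS (h ▸ h₂ ▸ hvS)).elim
      · rw [← h₁, h₂, h]
    intro t t' hne
    refine Set.disjoint_left.2 fun v hv hv' => hne ?_
    rcases hR t v hv with h | h <;> rcases hR t' v hv' with h' | h'
    · exact hp _ _ _ h h'
    · exact hcross _ _ _ h h'
    · exact (hcross _ _ _ h' h).symm
    · exact hσinj _ _ (hq _ _ _ h h')
  let e := (Finset.equivFinOfCardEq hcx).symm
  refine ⟨fun i => R (e i), fun i j hij => hRd _ _ (e.injective.ne hij), fun i => ⟨?_, ?_⟩⟩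
  · rw [hR₁]; exact haA _
  · rw [hR₂]; exact hbB _

/-- **Menger's theorem** for sets of vertices in a finite graph. -/
theorem exists_disjoint_paths_of_forall_separates {V : Type} [Finite V] (k : ℕ)
    (G : SimpleGraph V) (A B : Set V)
    (hsep : ∀ S : Finset V, Separates G A B S → k ≤ S.card) :
    ∃ P : Fin k → PathIn G, (Pairwise fun i j => Disjoint (P i).verts (P j).verts) ∧
      ∀ i, (P i).1 ∈ A ∧ (P i).2.1 ∈ B := by
  classical
  have := Fintype.ofFinite V
  induction G using WellFoundedLT.induction generalizing A B with
  | ind G ih =>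
  by_cases hbot : G = ⊥
  · subst hbot
    have hk := hsep (A ∩ B).toFinset (by
      rintro b hb ⟨a, ha, p, hp⟩
      cases p with
      | nil => exact hp b (by simp) (by simp [ha, hb])
      | cons h _ => exact h)
    let f := (Fin.castLEEmb hk).trans ((A ∩ B).toFinset.equivFin.symm.toEmbedding)
    refine ⟨fun i => ⟨f i, f i, .nil⟩, fun i j hij => ?_, fun i => ?_⟩
    · refine Set.disjoint_left.2 fun v hv hv' => hij ?_
      simp only [PathIn.verts, Set.mem_ofPred_eq, Path.nil_coe, Walk.support_nil,
        List.mem_singleton] at hv hv'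
      exact f.injective (Subtype.ext (hv.symm.trans hv'))
    · simpa using (f i).2
  · obtain ⟨x, y, hxy⟩ := ne_bot_iff_exists_adj.1 hbot
    have hlt : G.deleteEdges {s(x, y)} < G :=
      (G.deleteEdges_le _).lt_of_ne fun h => by
        rw [← h] at hxy
        simp at hxy
    by_cases hS : ∀ S : Finset V, Separates (G.deleteEdges {s(x, y)}) A B S → k ≤ S.card
    · obtain ⟨P, hPd, hP⟩ := ih _ hlt A B hS
      refine ⟨fun i => ⟨(P i).1, (P i).2.1, (P i).2.2.1.mapLe hlt.le, (P i).2.2.2.mapLe hlt.le⟩,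
        fun i j hij => ?_, hP⟩
      simpa [PathIn.verts] using hPd hij
    · push Not at hS
      obtain ⟨S, hS, hcard⟩ := hS
      have hreach : ∀ A B : Set V, Separates (G.deleteEdges {s(x, y)}) A B S →
          ¬ Separates G A B S → ReachAvoiding (G.deleteEdges {s(x, y)}) A S x ∨
            ReachAvoiding (G.deleteEdges {s(x, y)}) A S y := by
        intro A B hS hn
        simp only [Separates, not_forall, not_not] at hn
        obtain ⟨b, hb, hG⟩ := hn
        obtain ⟨u, v, huv, hne, hu⟩ := hG.exists_boundary (hS b hb)
        have huvxy : s(u, v) = s(x, y) := by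
          by_contra h
          exact hne (by simpa [deleteEdges_adj, huv] using h)
        rcases Sym2.eq_iff.1 huvxy with ⟨rfl, rfl⟩ | ⟨rfl, rfl⟩
        exacts [.inl hu, .inr hu]
      have hn : ¬ Separates G A B S := fun h => absurd (hsep S h) (by omega)
      rcases hreach A B hS hn with hA | hA <;>
        rcases hreach B A hS.symm (fun h => hn h.symm) with hB | hB
      · exact (hA.separates_trans hS hB).elim
      · exact exists_disjoint_paths_of_separates_deleteEdge hxy (fun A B => ih _ hlt A B)
          hsep hS hcard hA hB
      · rw [Sym2.eq_swap] at hlt hS hA hB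
        exact exists_disjoint_paths_of_separates_deleteEdge hxy.symm (fun A B => ih _ hlt A B)
          hsep hS hcard hA hB
      · exact (hA.separates_trans hS hB).elim

lemma SimpleGraph.Subgraph.Connected.exists_walk_support_subset {V : Type} {G : SimpleGraph V}
    {X : G.Subgraph} (hX : X.Connected) {u v : V} (hu : u ∈ X.verts) (hv : v ∈ X.verts) :
    ∃ p : G.Walk u v, ∀ w ∈ p.support, w ∈ X.verts := by
  obtain ⟨p⟩ := hX.preconnected ⟨u, hu⟩ ⟨v, hv⟩
  refine ⟨p.map X.hom, fun w hw => ?_⟩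
  erw [Walk.support_map, List.mem_map] at hw
  obtain ⟨z, _, rfl⟩ := hw
  exact z.2

lemma Touch.exists_walk {V : Type} {G : SimpleGraph V} {X Y : G.Subgraph} (h : Touch X Y)
    (hX : X.Connected) (hY : Y.Connected) {u v : V} (hu : u ∈ X.verts) (hv : v ∈ Y.verts) :
    ∃ p : G.Walk u v, ∀ w ∈ p.support, w ∈ X.verts ∨ w ∈ Y.verts := by
  have hm : ∃ x ∈ X.verts, ∃ y ∈ Y.verts, ∃ m : G.Walk x y, ∀ w ∈ m.support, w = x ∨ w = y := by
    rcases h with ⟨x, hx, hy⟩ | ⟨x, hx, y, hy, hxy⟩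
    · exact ⟨x, hx, x, hy, .nil, by simp⟩
    · exact ⟨x, hx, y, hy, .cons hxy .nil, by simp⟩
  obtain ⟨x, hx, y, hy, m, hm⟩ := hm
  obtain ⟨p, hp⟩ := hX.exists_walk_support_subset hu hx
  obtain ⟨q, hq⟩ := hY.exists_walk_support_subset hy hv
  refine ⟨(p.append m).append q, fun w hw => ?_⟩
  simp only [Walk.mem_support_append_iff] at hw
  rcases hw with (hw | hw) | hw
  · exact .inl (hp w hw)
  · rcases hm w hw with rfl | rfl
    exacts [.inl hx, .inr hy]
  · exact .inr (hq w hw)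

/-- A path meeting some element of `ℬ` has a final segment meeting the same elements, one of them
only in the first vertex of that segment. -/
lemma exists_suffix_meeting_once {V : Type} {G : SimpleGraph V} (ℬ : Set G.Subgraph) {u v : V}
    (p : G.Walk u v) (hp : p.IsPath) (hne : ∃ X ∈ ℬ, ∃ w ∈ p.support, w ∈ X.verts) :
    ∃ (u' : V) (q : G.Walk u' v), q.IsPath ∧
      (∀ Y ∈ ℬ, (∃ w ∈ p.support, w ∈ Y.verts) → ∃ w ∈ q.support, w ∈ Y.verts) ∧
      ∃ X ∈ ℬ, u' ∈ X.verts ∧ ∀ w ∈ q.support, w ∈ X.verts → w = u' := by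
  induction p with
  | nil =>
    obtain ⟨X, hX, w, hw, hwX⟩ := hne
    obtain rfl := List.mem_singleton.1 hw
    exact ⟨_, .nil, hp, fun _ _ h => h, X, hX, hwX, by simp⟩
  | @cons u m v h p ih =>
    by_cases hall : ∀ Y ∈ ℬ, (∃ w ∈ (Walk.cons h p).support, w ∈ Y.verts) →
        ∃ w ∈ p.support, w ∈ Y.verts
    · obtain ⟨X, hX, hmeet⟩ := hne
      obtain ⟨u', q, hq, hqm, hex⟩ := ih hp.of_cons ⟨X, hX, hall X hX hmeet⟩
      exact ⟨u', q, hq, fun Y hY hYm => hqm Y hY (hall Y hY hYm), hex⟩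
    · push Not at hall
      obtain ⟨X, hX, ⟨w, hw, hwX⟩, hn⟩ := hall
      have hcons : ∀ z ∈ (Walk.cons h p).support, z ∈ X.verts → z = u := by
        intro z hz hzX
        rw [Walk.support_cons, List.mem_cons] at hz
        exact hz.resolve_right fun hz => hn z hz hzX
      exact ⟨u, .cons h p, hp, fun _ _ h => h, X, hX, hcons w hw hwX ▸ hwX, hcons⟩

/-- Some path meets every element of a nonempty bramble. -/
lemma IsBramble.exists_path_meeting_all {V : Type} [Finite V] {G : SimpleGraph V}
    {ℬ : Set G.Subgraph} (hB : IsBramble ℬ) (hne : ℬ.Nonempty) :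
    ∃ (u v : V) (p : G.Walk u v), p.IsPath ∧ ∀ X ∈ ℬ, ∃ w ∈ p.support, w ∈ X.verts := by
  classical
  let missed {u v : V} (p : G.Walk u v) : Set G.Subgraph :=
    {X | X ∈ ℬ ∧ ∀ w ∈ p.support, w ∉ X.verts}
  suffices ∀ (n : ℕ) (u v : V) (p : G.Walk u v), p.IsPath → (missed p).ncard = n →
      (∃ X ∈ ℬ, ∃ w ∈ p.support, w ∈ X.verts) →
      ∃ (u v : V) (p : G.Walk u v), p.IsPath ∧ ∀ X ∈ ℬ, ∃ w ∈ p.support, w ∈ X.verts by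
    obtain ⟨X, hX⟩ := hne
    obtain ⟨x, hx⟩ := (hB.1 X hX).nonempty
    exact this _ x x .nil .nil rfl ⟨X, hX, x, by simp, hx⟩
  intro n
  induction n using Nat.strong_induction_on with
  | _ n ih =>
  intro u v p hp hn hmeet
  by_cases hall : ∀ X ∈ ℬ, ∃ w ∈ p.support, w ∈ X.verts
  · exact ⟨u, v, p, hp, hall⟩
  push Not at hall
  obtain ⟨Y, hY, hYp⟩ := hall
  by_cases hYq : ∃ (u' : V) (r : G.Walk u' v), r.IsPath ∧ (∃ w ∈ r.support, w ∈ Y.verts) ∧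
      ∀ Z ∈ ℬ, (∃ w ∈ p.support, w ∈ Z.verts) → ∃ w ∈ r.support, w ∈ Z.verts
  · obtain ⟨u', r, hr, ⟨y, hyr, hyY⟩, hrp⟩ := hYq
    refine ih _ ?_ u' v r hr rfl ⟨Y, hY, y, hyr, hyY⟩
    rw [← hn]
    refine Set.ncard_lt_ncard ⟨fun Z hZ => ⟨hZ.1, fun w hw hwZ => ?_⟩, fun h => ?_⟩
    · obtain ⟨z, hz, hzZ⟩ := hrp Z hZ.1 ⟨w, hw, hwZ⟩
      exact hZ.2 z hz hzZ
    · exact (h ⟨hY, hYp⟩ : Y ∈ missed r).2 y hyr hyY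
  · refine (hYq ?_).elim
    obtain ⟨u', q, hq, hqp, X, hX, huX, hXq⟩ := exists_suffix_meeting_once ℬ p hp hmeet
    by_cases hYq' : ∃ w ∈ q.support, w ∈ Y.verts
    · exact ⟨u', q, hq, hYq', hqp⟩
    obtain ⟨y, hy⟩ := (hB.1 Y hY).nonempty
    obtain ⟨c, hc⟩ := (hB.2 Y hY X hX).exists_walk (hB.1 Y hY) (hB.1 X hX) hy huX
    have hcq : ∀ w ∈ c.bypass.support, w ∈ q.support → w = u' := by
      intro w hw hwq
      rcases hc w (c.support_bypass_subset_support hw) with h | h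
      · exact (hYq' ⟨w, hwq, h⟩).elim
      · exact hXq w hwq h
    refine ⟨y, c.bypass.append q, ?_, ⟨y, by simp, hy⟩, fun Z hZ hZp => ?_⟩
    · rw [Walk.isPath_def, Walk.support_append, List.nodup_append']
      have hqn := hq.support_nodup
      refine ⟨c.bypass_isPath.support_nodup, hqn.tail, fun w hw hwq => ?_⟩
      obtain rfl := hcq w hw (List.mem_of_mem_tail hwq)
      rw [← Walk.cons_tail_support] at hqn
      exact (List.nodup_cons.1 hqn).1 hwq
    · obtain ⟨w, hw, hwZ⟩ := hqp Z hZ hZp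
      exact ⟨w, (Walk.mem_support_append_iff _ _).2 (.inr hw), hwZ⟩

lemma PathIn.exists_verts_eq_of_isChain {V : Type} {G : SimpleGraph V} (l : List V)
    (hne : l ≠ []) (hc : l.IsChain G.Adj) (hn : l.Nodup) :
    ∃ P : PathIn G, P.verts = {v | v ∈ l} :=
  ⟨⟨_, _, Walk.ofSupport l hne hc, by rwa [Walk.isPath_def, Walk.support_ofSupport]⟩,
    by simp [PathIn.verts]⟩

/-- A path meeting every element of a family of order at least `k * ℓ` splits into `ℓ` segments
each of which meets every element of some subfamily of order at least `k`. -/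
lemma exists_segments_of_brambleOrderAtLeast {V : Type} {G : SimpleGraph V} {k : ℕ} (hk : 1 ≤ k)
    (ℓ : ℕ) (l : List V) (hc : l.IsChain G.Adj) (hn : l.Nodup) (ℬ : Set G.Subgraph)
    (hl : ∀ X ∈ ℬ, ∃ v ∈ l, v ∈ X.verts) (hord : BrambleOrderAtLeast ℬ (k * ℓ)) :
    ∃ P : Fin ℓ → PathIn G, (Pairwise fun i j => Disjoint (P i).verts (P j).verts) ∧
      ∀ i, (∀ v ∈ (P i).verts, v ∈ l) ∧ ∃ 𝒞 ⊆ ℬ, BrambleOrderAtLeast 𝒞 k ∧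
        ∀ X ∈ 𝒞, ∃ v ∈ (P i).verts, v ∈ X.verts := by
  classical
  induction ℓ generalizing l ℬ with
  | zero => exact ⟨Fin.elim0, fun i => i.elim0, fun i => i.elim0⟩
  | succ ℓ ih =>
  let hit (t : ℕ) : Set G.Subgraph := {X | X ∈ ℬ ∧ ∃ v ∈ l.take t, v ∈ X.verts}
  have hex : ∃ t, BrambleOrderAtLeast (hit t) k := by
    refine ⟨l.length, fun S hS => ?_⟩
    refine (Nat.le_mul_of_pos_right k ℓ.succ_pos).trans
      (hord S fun X hX => hS X ⟨hX, by simpa using hl X hX⟩)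
  let t := Nat.find hex
  have ht : BrambleOrderAtLeast (hit t) k := Nat.find_spec hex
  have hS : ∃ S : Finset V, S.card ≤ k ∧ ∀ X ∈ hit t, ∃ v ∈ S, v ∈ X.verts := by
    rcases Nat.eq_zero_or_pos t with h | h
    · exact ⟨∅, by simp, by simp [hit, h]⟩
    · obtain ⟨s, hs⟩ : ∃ s, t = s + 1 := ⟨t - 1, by omega⟩
      have hmin := Nat.find_min hex (m := s) (by omega)
      simp only [BrambleOrderAtLeast, not_forall, not_le] at hmin
      obtain ⟨S, hS, hcard⟩ := hmin
      refine ⟨S ∪ l[s]?.toList.toFinset, ?_, ?_⟩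
      · refine (Finset.card_union_le _ _).trans ?_
        have : l[s]?.toList.toFinset.card ≤ 1 :=
          (List.toFinset_card_le _).trans (by cases l[s]? <;> simp)
        omega
      · rintro X ⟨hX, v, hv, hvX⟩
        rw [hs, List.take_add_one, List.mem_append] at hv
        rcases hv with hv | hv
        · obtain ⟨w, hw, hwX⟩ := hS X ⟨hX, v, hv, hvX⟩
          exact ⟨w, Finset.mem_union_left _ hw, hwX⟩
        · exact ⟨v, Finset.mem_union_right _ (List.mem_toFinset.2 hv), hvX⟩
  obtain ⟨S, hScard, hS⟩ := hS
  have hne : l.take t ≠ [] := by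
    intro h
    have := ht ∅ (by simp [hit, h])
    simp at this
    omega
  obtain ⟨P₀, hP₀⟩ := PathIn.exists_verts_eq_of_isChain _ hne (hc.take t)
    (hn.sublist (List.take_sublist _ _))
  obtain ⟨P, hPd, hP⟩ := ih (l.drop t) (hc.drop t) (hn.sublist (List.drop_sublist _ _))
    {X | X ∈ ℬ ∧ ∀ v ∈ l.take t, v ∉ X.verts}
    (by
      rintro X ⟨hX, hXt⟩
      obtain ⟨v, hv, hvX⟩ := hl X hX
      rw [← List.take_append_drop t l, List.mem_append] at hv
      exact ⟨v, hv.resolve_left fun h => hXt v h hvX, hvX⟩)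
    (by
      intro S' hS'
      have := hord (S ∪ S') (by
        intro X hX
        by_cases hXt : ∃ v ∈ l.take t, v ∈ X.verts
        · obtain ⟨w, hw, hwX⟩ := hS X ⟨hX, hXt⟩
          exact ⟨w, Finset.mem_union_left _ hw, hwX⟩
        · push Not at hXt
          obtain ⟨w, hw, hwX⟩ := hS' X ⟨hX, hXt⟩
          exact ⟨w, Finset.mem_union_right _ hw, hwX⟩)
      have := this.trans (Finset.card_union_le _ _)
      rw [Nat.mul_succ] at this
      omega)
  have hd : ∀ i, Disjoint P₀.verts (P i).verts := by
    intro i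
    refine Set.disjoint_left.2 fun v hv hv' => ?_
    rw [hP₀] at hv
    exact List.disjoint_take_drop hn le_rfl hv ((hP i).1 v hv')
  refine ⟨Fin.cons P₀ P, fun i j hij => ?_, fun i => ?_⟩
  · cases i using Fin.cases <;> cases j using Fin.cases
    · exact (hij rfl).elim
    · simpa using hd _
    · simpa using (hd _).symm
    · simpa using hPd fun h => hij (congrArg Fin.succ h)
  · cases i using Fin.cases with
    | zero =>
      simp only [Fin.cons_zero, hP₀]
      exact ⟨fun v hv => List.mem_of_mem_take hv, hit t, fun X hX => hX.1, ht, fun X hX => hX.2⟩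
    | succ i =>
      simp only [Fin.cons_succ]
      obtain ⟨h, 𝒞, h𝒞, h'⟩ := hP i
      exact ⟨fun v hv => List.mem_of_mem_drop (h v hv), 𝒞, fun X hX => (h𝒞 hX).1, h'⟩

/-- If `G` contains a bramble of order at least `k·ℓ`, then `G` contains `ℓ`
disjoint paths `P₁, …, P_ℓ` such that between every two of them there are `k`
disjoint paths, each with one endpoint in `P_i` and the other in `P_j`. -/
theorem disjoint_paths_of_bramble {V : Type} [Fintype V] {G : SimpleGraph V}
    (k ℓ : ℕ) (hk : 1 ≤ k) (hℓ : 1 ≤ ℓ) (ℬ : Set G.Subgraph)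
    (hB : IsBramble ℬ) (hord : BrambleOrderAtLeast ℬ (k * ℓ)) :
    ∃ P : Fin ℓ → PathIn G,
      (Pairwise fun i j => Disjoint (P i).verts (P j).verts) ∧
      ∀ i j : Fin ℓ, i ≠ j →
        ∃ Q : Fin k → PathIn G,
          (Pairwise fun a b => Disjoint (Q a).verts (Q b).verts) ∧
          ∀ a : Fin k, (Q a).1 ∈ (P i).verts ∧ (Q a).2.1 ∈ (P j).verts := by
  classical
  have hne : ℬ.Nonempty := by
    by_contra h
    rw [Set.not_nonempty_iff_eq_empty] at h
    have h0 := hord ∅ (by simp [h])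
    have := Nat.mul_pos hk hℓ
    simp only [Finset.card_empty] at h0
    omega
  obtain ⟨u, v, p, hp, hpB⟩ := hB.exists_path_meeting_all hne
  obtain ⟨P, hPd, hP⟩ := exists_segments_of_brambleOrderAtLeast hk ℓ p.support
    p.isChain_adj_support hp.support_nodup ℬ hpB hord
  refine ⟨P, hPd, fun i j _ => exists_disjoint_paths_of_forall_separates k G _ _ fun S hS => ?_⟩
  by_contra hcard
  have avoid : ∀ i, ∃ X ∈ ℬ, (∃ w ∈ (P i).verts, w ∈ X.verts) ∧ ∀ w ∈ X.verts, w ∉ S := by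
    intro i
    obtain ⟨_, 𝒞, h𝒞, hord𝒞, hmeet⟩ := hP i
    have hn := mt (hord𝒞 S) hcard
    push Not at hn
    obtain ⟨X, hX, hXS⟩ := hn
    exact ⟨X, h𝒞 hX, hmeet X hX, fun w hw hwS => hXS w hwS hw⟩
  obtain ⟨X, hX, ⟨x, hxP, hxX⟩, hXS⟩ := avoid i
  obtain ⟨Y, hY, ⟨y, hyP, hyY⟩, hYS⟩ := avoid j
  obtain ⟨c, hc⟩ := (hB.2 X hX Y hY).exists_walk (hB.1 X hX) (hB.1 Y hY) hxX hyY
  exact hS y hyP ⟨x, hxP, c, fun w hw => (hc w hw).elim (hXS w) (hYS w)⟩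
end

section
/- Let 𝒫 be a grid-like-minor (of some order ℓ) in a finite simple graph G, and let H be the intersection graph of 𝒫. Then H is a minor of the cartesian product G □ K₂. In particular, if 𝒫 is a grid-like-minor of order ℓ, then G □ K₂ contains K_ℓ as a minor. -/
open SimpleGraph

/-- The union of the branch sets of a minor model over a connected vertex set is connected. -/
lemma connected_induce_biUnion {β γ : Type*} {K : SimpleGraph β} {G : SimpleGraph γ}
    {C : β → Set γ} (hC : ∀ b, (G.induce (C b)).Connected)
    (hKG : ∀ a b, K.Adj a b → ∃ u ∈ C a, ∃ v ∈ C b, G.Adj u v)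
    {S : Set β} (hS : (K.induce S).Connected) :
    (G.induce (⋃ b ∈ S, C b)).Connected := by
  have hsub : ∀ b ∈ S, C b ⊆ ⋃ b ∈ S, C b := fun b hb => Set.subset_biUnion_of_mem hb
  have hbranch : ∀ (b : β) (hb : b ∈ S) (x y : γ) (hx : x ∈ C b) (hy : y ∈ C b),
      (G.induce (⋃ b ∈ S, C b)).Reachable ⟨x, hsub b hb hx⟩ ⟨y, hsub b hb hy⟩ :=
    fun b hb x y hx hy =>
      ((hC b).preconnected ⟨x, hx⟩ ⟨y, hy⟩).map (induceHomOfLE G (hsub b hb)).toHom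
  have hwalk : ∀ (p q : S), (K.induce S).Walk p q →
      ∀ (x y : γ) (hx : x ∈ C p) (hy : y ∈ C q),
      (G.induce (⋃ b ∈ S, C b)).Reachable ⟨x, hsub p p.2 hx⟩ ⟨y, hsub q q.2 hy⟩ := by
    intro p q w
    induction w with
    | @nil p => exact hbranch p p.2
    | @cons p r q hadj _ ih =>
      intro x y hx hy
      obtain ⟨u, hu, v, hv, huv⟩ := hKG p r hadj
      have hstep : (G.induce (⋃ b ∈ S, C b)).Adj ⟨u, hsub p p.2 hu⟩ ⟨v, hsub r r.2 hv⟩ := huv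
      exact ((hbranch p p.2 x u hx hu).trans hstep.reachable).trans (ih v y hv hy)
  obtain ⟨b⟩ := hS.nonempty
  obtain ⟨x⟩ := (hC b).nonempty
  have : Nonempty (⋃ b ∈ S, C b : Set γ) := ⟨⟨x, hsub b b.2 x.2⟩⟩
  refine ⟨?_⟩
  rintro ⟨x, hx⟩ ⟨y, hy⟩
  obtain ⟨p, hp, hxp⟩ := Set.mem_iUnion₂.1 hx
  obtain ⟨q, hq, hyq⟩ := Set.mem_iUnion₂.1 hy
  obtain ⟨w⟩ := hS.preconnected ⟨p, hp⟩ ⟨q, hq⟩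
  exact hwalk _ _ w x y hxp hyq

/-- The minor relation is transitive. -/
lemma MinorOf.trans {α β γ : Type*} {H : SimpleGraph α} {K : SimpleGraph β} {G : SimpleGraph γ}
    (hHK : MinorOf H K) (hKG : MinorOf K G) : MinorOf H G := by
  obtain ⟨B, hBd, hBc, hBa⟩ := hHK
  obtain ⟨C, hCd, hCc, hCa⟩ := hKG
  refine ⟨fun a => ⋃ b ∈ B a, C b, fun a a' haa' => ?_,
    fun a => connected_induce_biUnion hCc hCa (hBc a), fun a a' haa' => ?_⟩
  · simp only [Set.disjoint_iUnion_left, Set.disjoint_iUnion_right]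
    exact fun b' hb' b hb => hCd ((hBd haa').ne_of_mem hb hb')
  · obtain ⟨b, hb, b', hb', hbb'⟩ := hBa a a' haa'
    obtain ⟨u, hu, v, hv, huv⟩ := hCa b b' hbb'
    exact ⟨u, Set.mem_biUnion hb hu, v, Set.mem_biUnion hb' hv, huv⟩

/-- A copy of a connected vertex set inside one layer of a cartesian product is connected. -/
lemma connected_induce_boxProd_layer {V W : Type*} {G : SimpleGraph V} (K : SimpleGraph W)
    {S : Set V} (hS : (G.induce S).Connected) (c : W) :
    ((G □ K).induce {x | x.1 ∈ S ∧ x.2 = c}).Connected := by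
  let f : G.induce S →g (G □ K).induce {x | x.1 ∈ S ∧ x.2 = c} :=
    { toFun := fun v => ⟨(v, c), v.2, rfl⟩
      map_rel' := fun h => Or.inl ⟨h, rfl⟩ }
  refine hS.map f ?_
  rintro ⟨⟨v, _⟩, hv, rfl⟩
  exact ⟨⟨v, hv⟩, rfl⟩

/-- If the intersection graph of a set of paths in `G` is `n`-colorable, then it is a minor of
`G □ Kₙ`: place each path in the layer given by its color. -/
lemma minorOf_boxProd_of_colorable {V : Type} {G : SimpleGraph V} {𝒬 : Set (PathIn G)} {n : ℕ}
    (h : (pathIntersectionGraph G 𝒬).Colorable n) :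
    MinorOf (pathIntersectionGraph G 𝒬) (G □ completeGraph (Fin n)) := by
  obtain ⟨c⟩ := h
  refine ⟨fun P => {x | x.1 ∈ (P : PathIn G).verts ∧ x.2 = c P}, fun P Q hPQ => ?_,
    fun P => connected_induce_boxProd_layer _
      (Walk.connected_induce_support (P : PathIn G).2.2.1) _, fun P Q hPQ => ?_⟩
  · refine Set.disjoint_left.2 fun x ⟨hxP, hcP⟩ ⟨hxQ, hcQ⟩ => ?_
    have hadj : (pathIntersectionGraph G 𝒬).Adj P Q := ⟨hPQ, Or.inl ⟨x.1, hxP, hxQ⟩⟩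
    exact c.valid hadj (hcP.symm.trans hcQ)
  · obtain ⟨v, hvP, hvQ⟩ : ∃ v, v ∈ (P : PathIn G).verts ∧ v ∈ (Q : PathIn G).verts :=
      hPQ.2.elim id fun ⟨v, hvQ, hvP⟩ => ⟨v, hvP, hvQ⟩
    exact ⟨(v, c P), ⟨hvP, rfl⟩, (v, c Q), ⟨hvQ, rfl⟩, Or.inr ⟨c.valid hPQ, rfl⟩⟩

/-- If `𝒬` is a grid-like-minor of order `ℓ` in `G`, then its intersection
graph is a minor of `G □ K₂`; in particular `G □ K₂` has a `K_ℓ`-minor. -/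
theorem gridLikeMinor_minor_boxProd {V : Type} [Fintype V] {G : SimpleGraph V}
    (ℓ : ℕ) (𝒬 : Set (PathIn G)) (h : IsGridLikeMinor G ℓ 𝒬) :
    MinorOf (pathIntersectionGraph G 𝒬) (G.boxProd (completeGraph (Fin 2))) ∧
    MinorOf (completeGraph (Fin ℓ)) (G.boxProd (completeGraph (Fin 2))) := by
  exact ⟨minorOf_boxProd_of_colorable h.1, h.2.trans (minorOf_boxProd_of_colorable h.1)⟩
end
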